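/- Let W be the Coxeter group of type F₄ on generators s₁,s₂,s₃,s₄, and let u = (s₁s₂s₃s₄)⁶ be its longest element, a central involution. Then H²(W/⟨u⟩, ℂˣ) is isomorphic to ℤ/2 × ℤ/2. -/

import Mathlib

variable (k : Type*) [Field k] (G : Type*) [Group G]

/-- A normalized 2-cocycle on `G` with values in `kˣ` (trivial `G`-action):
`σ(g,h)σ(gh,l) = σ(h,l)σ(g,hl)` and `σ(1,g) = σ(g,1) = 1`. -/
def IsCocycle (σ : G → G → kˣ) : Prop :=
  (∀ g h l : G, σ g h * σ (g * h) l = σ h l * σ g (h * l)) ∧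
    (∀ g : G, σ 1 g = 1) ∧ (∀ g : G, σ g 1 = 1)

/-- A 2-coboundary: `∂γ(g,h) = γ(g)γ(h)γ(gh)⁻¹` for some `γ` with `γ(1) = 1`. -/
def IsCoboundary (σ : G → G → kˣ) : Prop :=
  ∃ γ : G → kˣ, γ 1 = 1 ∧ ∀ g h : G, σ g h = γ g * γ h * (γ (g * h))⁻¹

/-- The group `Z²(G,kˣ)` of 2-cocycles, as a subgroup of the pointwise product group. -/
def Z2 : Subgroup (G → G → kˣ) where
  carrier := {σ | IsCocycle k G σ}
  one_mem' := ⟨fun _ _ _ => by simp, fun _ => rfl, fun _ => rfl⟩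
  mul_mem' := by
    rintro σ ω ⟨hσ1, hσ2, hσ3⟩ ⟨hω1, hω2, hω3⟩
    refine ⟨fun g h l => ?_, fun g => ?_, fun g => ?_⟩
    · simp only [Pi.mul_apply]
      rw [mul_mul_mul_comm, hσ1 g h l, hω1 g h l, mul_mul_mul_comm]
    · simp only [Pi.mul_apply, hσ2 g, hω2 g, one_mul]
    · simp only [Pi.mul_apply, hσ3 g, hω3 g, one_mul]
  inv_mem' := by
    rintro σ ⟨h1, h2, h3⟩
    refine ⟨fun g h l => ?_, fun g => ?_, fun g => ?_⟩
    · simp only [Pi.inv_apply]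
      rw [← mul_inv, ← mul_inv, h1 g h l]
    · simp only [Pi.inv_apply, h2 g, inv_one]
    · simp only [Pi.inv_apply, h3 g, inv_one]

/-- The subgroup `B²(G,kˣ)` of 2-coboundaries inside `Z²(G,kˣ)`. -/
def B2 : Subgroup (Z2 k G) where
  carrier := {σ | IsCoboundary k G (σ : G → G → kˣ)}
  one_mem' := ⟨fun _ => 1, rfl, fun g h => by simp⟩
  mul_mem' := by
    rintro σ ω ⟨γ, hγ1, hγ⟩ ⟨δ, hδ1, hδ⟩
    refine ⟨γ * δ, by simp [hγ1, hδ1], fun g h => ?_⟩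
    show (σ : G → G → kˣ) g h * (ω : G → G → kˣ) g h = _
    rw [hγ g h, hδ g h]
    simp only [Pi.mul_apply, mul_inv]
    ac_rfl
  inv_mem' := by
    rintro σ ⟨γ, hγ1, hγ⟩
    refine ⟨γ⁻¹, by simp [hγ1], fun g h => ?_⟩
    show ((σ : G → G → kˣ) g h)⁻¹ = _
    rw [hγ g h]
    simp only [Pi.inv_apply, mul_inv, inv_inv]

/-- The second cohomology group `H²(G,kˣ) = Z²(G,kˣ)/B²(G,kˣ)` with its usual
(pointwise-multiplication-induced) group structure. -/
abbrev H2 := Z2 k G ⧸ B2 k G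

/-- The relations `(sᵢsⱼ)^{m i j} = 1` of a Coxeter presentation (with `m i i = 1`,
so that the generators are involutions). -/
def coxeterRels {n : ℕ} (m : Fin n → Fin n → ℕ) : Set (FreeGroup (Fin n)) :=
  ⋃ (i : Fin n) (j : Fin n), {(FreeGroup.of i * FreeGroup.of j) ^ m i j}

/-- The Coxeter group presented by the matrix `m`. -/
abbrev CoxGroup {n : ℕ} (m : Fin n → Fin n → ℕ) := PresentedGroup (coxeterRels m)

/-- The simple reflections. -/
def coxS {n : ℕ} (m : Fin n → Fin n → ℕ) (i : Fin n) : CoxGroup m := PresentedGroup.of i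

/-- The Coxeter element `s₁ s₂ ⋯ sₙ`. -/
def coxProd {n : ℕ} (m : Fin n → Fin n → ℕ) : CoxGroup m :=
  (List.ofFn fun i => coxS m i).prod

/-- The Coxeter matrix of type `F₄`: `(s₁s₂)³ = (s₃s₄)³ = 1`, `(s₂s₃)⁴ = 1`,
and commuting relations otherwise (0-indexed). -/
def mF4 : Fin 4 → Fin 4 → ℕ := fun i j =>
  if i = j then 1
  else if (i = 0 ∧ j = 1) ∨ (i = 1 ∧ j = 0) ∨ (i = 2 ∧ j = 3) ∨ (i = 3 ∧ j = 2) then 3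
  else if (i = 1 ∧ j = 2) ∨ (i = 2 ∧ j = 1) then 4
  else 2

set_option linter.all false

theorem f4_key {E : Type*} [Group E] (t₁ t₂ t₃ t₄ z : E)
    (hz1 : ∀ x : E, t₁ * (z * x) = z * (t₁ * x)) (hz2 : ∀ x : E, t₂ * (z * x) = z * (t₂ * x))
    (hz3 : ∀ x : E, t₃ * (z * x) = z * (t₃ * x)) (hz4 : ∀ x : E, t₄ * (z * x) = z * (t₄ * x))
    (hzz : ∀ x : E, z * (z * x) = x)
    (q1 : ∀ x : E, t₁ * (t₁ * x) = x)
    (q2 : ∀ x : E, t₂ * (t₂ * x) = x)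
    (q3 : ∀ x : E, t₃ * (t₃ * x) = x)
    (q4 : ∀ x : E, t₄ * (t₄ * x) = x)
    (r12 : ∀ x : E, t₂ * (t₁ * (t₂ * x)) = t₁ * (t₂ * (t₁ * x)))
    (r34 : ∀ x : E, t₄ * (t₃ * (t₄ * x)) = t₃ * (t₄ * (t₃ * x)))
    (r13 : ∀ x : E, t₃ * (t₁ * x) = t₁ * (t₃ * x))
    (r14 : ∀ x : E, t₄ * (t₁ * x) = t₁ * (t₄ * x))
    (r24 : ∀ x : E, t₄ * (t₂ * x) = t₂ * (t₄ * x))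
    (r23 : ∀ x : E, t₃ * (t₂ * (t₃ * (t₂ * x))) = z * (t₂ * (t₃ * (t₂ * (t₃ * x)))))
    (hc : t₁ * (t₁ * t₂ * t₃ * t₄) ^ 6 = (t₁ * t₂ * t₃ * t₄) ^ 6 * t₁) : z = 1 := by
  have n1 : ∀ x : E, t₄ * (t₃ * (t₂ * (t₄ * x))) = t₃ * (t₄ * (t₃ * (t₂ * x))) := by
    intro x
    have e := (r34 (t₂ * x)).symm.trans (congrArg (fun y => t₄ * (t₃ * (y))) (r24 x))
    try simp only [hz1, hz2, hz3, hz4, hzz] at e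
    first | exact e | exact e.symm | (rw [← e, hzz]) | (rw [e, hzz])
  have n2 : ∀ x : E, t₄ * (t₃ * (t₂ * (t₁ * (t₄ * x)))) = t₃ * (t₄ * (t₃ * (t₂ * (t₁ * x)))) := by
    intro x
    have e := (n1 (t₁ * x)).symm.trans (congrArg (fun y => t₄ * (t₃ * (t₂ * (y)))) (r14 x))
    try simp only [hz1, hz2, hz3, hz4, hzz] at e
    first | exact e | exact e.symm | (rw [← e, hzz]) | (rw [e, hzz])
  have n3 : ∀ x : E, t₃ * (t₂ * (t₁ * (t₃ * (t₂ * (t₁ * x))))) = z * (t₂ * (t₃ * (t₂ * (t₁ * (t₃ * (t₂ * x)))))) := by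
    intro x
    have e := (r23 (t₁ * (t₂ * x))).symm.trans (congrArg (fun y => t₃ * (t₂ * (t₃ * (y)))) (r12 x))
    try simp only [r13, hz1, hz2, hz3, hz4, hzz] at e
    first | exact e | exact e.symm | (rw [← e, hzz]) | (rw [e, hzz])
  have n4 : ∀ x : E, t₄ * (t₃ * (t₂ * (t₃ * (t₄ * (t₃ * x))))) = t₃ * (t₄ * (t₃ * (t₂ * (t₃ * (t₄ * x))))) := by
    intro x
    have e := (n1 (t₃ * (t₄ * x))).symm.trans (congrArg (fun y => t₄ * (t₃ * (t₂ * (y)))) (r34 x))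
    try simp only [hz1, hz2, hz3, hz4, hzz] at e
    first | exact e | exact e.symm | (rw [← e, hzz]) | (rw [e, hzz])
  have n5 : ∀ x : E, t₄ * (t₃ * (t₂ * (t₁ * (t₃ * (t₄ * (t₃ * x)))))) = t₃ * (t₄ * (t₃ * (t₂ * (t₁ * (t₃ * (t₄ * x)))))) := by
    intro x
    have e := (n2 (t₃ * (t₄ * x))).symm.trans (congrArg (fun y => t₄ * (t₃ * (t₂ * (t₁ * (y))))) (r34 x))
    try simp only [hz1, hz2, hz3, hz4, hzz] at e
    first | exact e | exact e.symm | (rw [← e, hzz]) | (rw [e, hzz])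
  have n6 : ∀ x : E, t₄ * (t₃ * (t₂ * (t₁ * (t₃ * (t₂ * (t₄ * (t₃ * (t₂ * (t₃ * x))))))))) = z * (t₃ * (t₄ * (t₃ * (t₂ * (t₁ * (t₃ * (t₂ * (t₄ * (t₃ * (t₂ * x)))))))))) := by
    intro x
    have e := (n5 (t₂ * (t₃ * (t₂ * x)))).symm.trans (congrArg (fun y => t₄ * (t₃ * (t₂ * (t₁ * (t₃ * (t₄ * (y))))))) (r23 x))
    try simp only [r24, hz1, hz2, hz3, hz4, hzz] at e
    first | exact e | exact e.symm | (rw [← e, hzz]) | (rw [e, hzz])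
  have n7 : ∀ x : E, t₄ * (t₃ * (t₂ * (t₁ * (t₃ * (t₂ * (t₄ * (t₃ * (t₂ * (t₁ * (t₃ * x)))))))))) = z * (t₃ * (t₄ * (t₃ * (t₂ * (t₁ * (t₃ * (t₂ * (t₄ * (t₃ * (t₂ * (t₁ * x))))))))))) := by
    intro x
    have e := (n6 (t₁ * x)).symm.trans (congrArg (fun y => t₄ * (t₃ * (t₂ * (t₁ * (t₃ * (t₂ * (t₄ * (t₃ * (t₂ * (y)))))))))) (r13 x))
    try simp only [hz1, hz2, hz3, hz4, hzz] at e
    first | exact e | exact e.symm | (rw [← e, hzz]) | (rw [e, hzz])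
  have n8 : ∀ x : E, t₄ * (t₃ * (t₂ * (t₁ * (t₃ * (t₂ * (t₃ * (t₄ * (t₃ * (t₂ * (t₃ * (t₄ * x))))))))))) = z * (t₃ * (t₄ * (t₃ * (t₂ * (t₁ * (t₃ * (t₂ * (t₃ * (t₄ * (t₃ * (t₂ * (t₃ * x)))))))))))) := by
    intro x
    have e := (n6 (t₄ * (t₃ * x))).symm.trans (congrArg (fun y => t₄ * (t₃ * (t₂ * (t₁ * (t₃ * (t₂ * (y))))))) (n4 x))
    try simp only [n1, hz1, hz2, hz3, hz4, hzz] at e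
    first | exact e | exact e.symm | (rw [← e, hzz]) | (rw [e, hzz])
  have n9 : ∀ x : E, t₄ * (t₃ * (t₂ * (t₁ * (t₃ * (t₂ * (t₃ * (t₄ * (t₃ * (t₂ * (t₁ * (t₃ * (t₄ * x)))))))))))) = z * (t₃ * (t₄ * (t₃ * (t₂ * (t₁ * (t₃ * (t₂ * (t₃ * (t₄ * (t₃ * (t₂ * (t₁ * (t₃ * x))))))))))))) := by
    intro x
    have e := (n8 (t₁ * x)).symm.trans (congrArg (fun y => t₄ * (t₃ * (t₂ * (t₁ * (t₃ * (t₂ * (t₃ * (t₄ * (t₃ * (t₂ * (t₃ * (y)))))))))))) (r14 x))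
    try simp only [r13, hz1, hz2, hz3, hz4, hzz] at e
    first | exact e | exact e.symm | (rw [← e, hzz]) | (rw [e, hzz])
  have n10 : ∀ x : E, t₄ * (t₃ * (t₂ * (t₁ * (t₃ * (t₂ * (t₃ * (t₄ * (t₃ * (t₂ * (t₁ * (t₃ * (t₂ * (t₄ * x))))))))))))) = z * (t₃ * (t₄ * (t₃ * (t₂ * (t₁ * (t₃ * (t₂ * (t₃ * (t₄ * (t₃ * (t₂ * (t₁ * (t₃ * (t₂ * x)))))))))))))) := by
    intro x
    have e := (n9 (t₂ * x)).symm.trans (congrArg (fun y => t₄ * (t₃ * (t₂ * (t₁ * (t₃ * (t₂ * (t₃ * (t₄ * (t₃ * (t₂ * (t₁ * (t₃ * (y))))))))))))) (r24 x))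
    try simp only [hz1, hz2, hz3, hz4, hzz] at e
    first | exact e | exact e.symm | (rw [← e, hzz]) | (rw [e, hzz])
  have n11 : ∀ x : E, t₄ * (t₃ * (t₂ * (t₁ * (t₃ * (t₂ * (t₃ * (t₄ * (t₃ * (t₂ * (t₁ * (t₃ * (t₂ * (t₃ * (t₄ * (t₃ * x))))))))))))))) = z * (t₃ * (t₄ * (t₃ * (t₂ * (t₁ * (t₃ * (t₂ * (t₃ * (t₄ * (t₃ * (t₂ * (t₁ * (t₃ * (t₂ * (t₃ * (t₄ * x)))))))))))))))) := by
    intro x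
    have e := (n10 (t₃ * (t₄ * x))).symm.trans (congrArg (fun y => t₄ * (t₃ * (t₂ * (t₁ * (t₃ * (t₂ * (t₃ * (t₄ * (t₃ * (t₂ * (t₁ * (t₃ * (t₂ * (y)))))))))))))) (r34 x))
    try simp only [hz1, hz2, hz3, hz4, hzz] at e
    first | exact e | exact e.symm | (rw [← e, hzz]) | (rw [e, hzz])
  have e := congrArg (fun y => y * (1 : E)) hc
  simp only [pow_succ, pow_zero, one_mul, mul_assoc] at e
  simp only [q1, q2, q3, q4, r12, r34, r13, r14, r24, r23, n1, n2, n3, n4, n5, n6, n7, n8, n9, n10, n11,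
    hz1, hz2, hz3, hz4, hzz] at e
  simpa using e

/-- The central extension of `Γ` by `ℂˣ` attached to a 2-cocycle. -/
@[ext]
structure CExt {Γ : Type} [Group Γ] (σ : Z2 ℂ Γ) where
  a : ℂˣ
  g : Γ

namespace CExt

section basic
variable {Γ : Type} [Group Γ] {σ τ : Z2 ℂ Γ}

instance : Mul (CExt σ) := ⟨fun x y => ⟨x.a * y.a * σ.1 x.g y.g, x.g * y.g⟩⟩
instance : One (CExt σ) := ⟨⟨1, 1⟩⟩
instance : Inv (CExt σ) := ⟨fun x => ⟨(x.a * σ.1 x.g⁻¹ x.g)⁻¹, x.g⁻¹⟩⟩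

theorem mul_a (x y : CExt σ) : (x * y).a = x.a * y.a * σ.1 x.g y.g := rfl
theorem mul_g (x y : CExt σ) : (x * y).g = x.g * y.g := rfl
theorem one_a : (1 : CExt σ).a = 1 := rfl
theorem one_g : (1 : CExt σ).g = 1 := rfl
theorem inv_a (x : CExt σ) : (x⁻¹).a = (x.a * σ.1 x.g⁻¹ x.g)⁻¹ := rfl
theorem inv_g (x : CExt σ) : (x⁻¹).g = x.g⁻¹ := rfl

instance : Group (CExt σ) := Group.ofLeftAxioms
  (by
    intro x y z
    ext1
    · simp only [mul_a, mul_g]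
      have := σ.2.1 x.g y.g z.g
      calc x.a * y.a * σ.1 x.g y.g * z.a * σ.1 (x.g * y.g) z.g
          = x.a * y.a * z.a * (σ.1 x.g y.g * σ.1 (x.g * y.g) z.g) := by ac_rfl
        _ = _ := by rw [this]; ac_rfl
    · simp only [mul_g, mul_assoc])
  (by
    intro x
    ext1
    · simp only [mul_a, one_a, one_g, one_mul, σ.2.2.1, mul_one]
    · simp only [mul_g, one_g, one_mul])
  (by
    intro x
    ext1
    · simp only [mul_a, inv_a, inv_g, one_a]
      rw [mul_inv]
      calc _ = (x.a⁻¹ * x.a) * ((σ.1 x.g⁻¹ x.g)⁻¹ * σ.1 x.g⁻¹ x.g) := by ac_rfl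
        _ = 1 := by simp
    · simp only [mul_g, inv_g, one_g, inv_mul_cancel])

/-- The projection to `Γ`. -/
def pr : CExt σ →* Γ where
  toFun x := x.g
  map_one' := rfl
  map_mul' _ _ := rfl

theorem pr_apply (x : CExt σ) : pr x = x.g := rfl

/-- The inclusion of the scalars. -/
def io : ℂˣ →* CExt σ where
  toFun a := ⟨a, 1⟩
  map_one' := rfl
  map_mul' a b := by
    ext1
    · simp only [mul_a, σ.2.2.1, mul_one]
    · simp only [mul_g, one_mul]

theorem io_inj {a b : ℂˣ} (h : (io a : CExt σ) = io b) : a = b := congrArg CExt.a h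

theorem io_comm (a : ℂˣ) (x : CExt σ) : io a * x = x * io a := by
  ext1
  · simp only [mul_a, io, MonoidHom.coe_mk, OneHom.coe_mk, σ.2.2.1, σ.2.2.2, mul_one, mul_comm]
  · simp [mul_g, io]

theorem eq_io (x : CExt σ) (h : pr x = 1) : ∃ a : ℂˣ, x = io a := ⟨x.a, by
  ext1
  · rfl
  · exact h⟩

theorem pr_io (a : ℂˣ) : pr (io a : CExt σ) = 1 := rfl

/-- Product of elements of two extensions. -/
def mm (x : CExt σ) (y : CExt τ) : CExt (σ * τ) := ⟨x.a * y.a, x.g⟩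

theorem mm_mul (x x' : CExt σ) (y y' : CExt τ) (h : x.g = y.g) (h' : x'.g = y'.g) :
    mm (x * x') (y * y') = mm x y * mm x' y' := by
  ext1
  · simp only [mm, mul_a]
    rw [← h, ← h']
    change _ = x.a * y.a * (x'.a * y'.a) * (σ.1 x.g x'.g * τ.1 x.g x'.g)
    ac_rfl
  · rfl

theorem mm_one : mm (1 : CExt σ) (1 : CExt τ) = 1 := by
  ext1
  · simp [mm, one_a]
  · rfl

theorem mm_io (a b : ℂˣ) : mm (io a : CExt σ) (io b : CExt τ) = io (a * b) := rfl

theorem mm_pow (x : CExt σ) (y : CExt τ) (h : x.g = y.g) (n : ℕ) :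
    mm (x ^ n) (y ^ n) = mm x y ^ n := by
  induction n with
  | zero => simp [mm_one]
  | succ n ih =>
    rw [pow_succ, pow_succ, pow_succ, mm_mul _ _ _ _ _ h, ih]
    rw [← pr_apply, ← pr_apply, map_pow, map_pow, pr_apply, pr_apply, h]

end basic

end CExt

/-- Coxeter relations of type `F₄`. -/
structure F4Rel {H : Type} [Group H] (t : Fin 4 → H) : Prop where
  sq : ∀ i, t i * t i = 1
  r01 : (t 0 * t 1) ^ 3 = 1
  r23 : (t 2 * t 3) ^ 3 = 1
  c02 : t 0 * t 2 = t 2 * t 0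
  c03 : t 0 * t 3 = t 3 * t 0
  c13 : t 1 * t 3 = t 3 * t 1
  r12 : (t 1 * t 2) ^ 4 = 1

/-- Normalized lifts of the generators. -/
structure Lift {Γ : Type} [Group Γ] (s : Fin 4 → Γ) (σ : Z2 ℂ Γ) (t : Fin 4 → CExt σ)
    (b c d : ℂˣ) : Prop where
  proj : ∀ i, (t i).g = s i
  sq : ∀ i, t i * t i = 1
  r01 : (t 0 * t 1) ^ 3 = 1
  r23 : (t 2 * t 3) ^ 3 = 1
  c02 : t 0 * t 2 = CExt.io c * (t 2 * t 0)
  c03 : t 0 * t 3 = CExt.io c * (t 3 * t 0)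
  c13 : t 1 * t 3 = CExt.io c * (t 3 * t 1)
  r12 : (t 1 * t 2) ^ 4 = CExt.io b
  cox : (t 0 * t 1 * t 2 * t 3) ^ 6 = CExt.io d

theorem Lift.mul {Γ : Type} [Group Γ] {s : Fin 4 → Γ} {σ τ : Z2 ℂ Γ} {t : Fin 4 → CExt σ}
    {t' : Fin 4 → CExt τ} {b c d b' c' d' : ℂˣ} (h : Lift s σ t b c d) (h' : Lift s τ t' b' c' d') :
    Lift s (σ * τ) (fun i => CExt.mm (t i) (t' i)) (b * b') (c * c') (d * d') := by
  have e : ∀ i, (t i).g = (t' i).g := fun i => by rw [h.proj, h'.proj]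
  have e2 : ∀ i j, (t i * t j).g = (t' i * t' j).g := fun i j => by
    rw [CExt.mul_g, CExt.mul_g, e, e]
  refine ⟨fun i => h.proj i, fun i => ?_, ?_, ?_, ?_, ?_, ?_, ?_, ?_⟩
  · rw [← CExt.mm_mul _ _ _ _ (e _) (e _), h.sq, h'.sq, CExt.mm_one]
  · rw [← CExt.mm_mul _ _ _ _ (e _) (e _), ← CExt.mm_pow _ _ (e2 _ _), h.r01, h'.r01, CExt.mm_one]
  · rw [← CExt.mm_mul _ _ _ _ (e _) (e _), ← CExt.mm_pow _ _ (e2 _ _), h.r23, h'.r23, CExt.mm_one]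
  · rw [← CExt.mm_mul _ _ _ _ (e _) (e _), h.c02, h'.c02, CExt.mm_mul (CExt.io c) _ (CExt.io c') _ rfl (e2 _ _),
      CExt.mm_mul _ _ _ _ (e _) (e _), CExt.mm_io]
  · rw [← CExt.mm_mul _ _ _ _ (e _) (e _), h.c03, h'.c03, CExt.mm_mul (CExt.io c) _ (CExt.io c') _ rfl (e2 _ _),
      CExt.mm_mul _ _ _ _ (e _) (e _), CExt.mm_io]
  · rw [← CExt.mm_mul _ _ _ _ (e _) (e _), h.c13, h'.c13, CExt.mm_mul (CExt.io c) _ (CExt.io c') _ rfl (e2 _ _),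
      CExt.mm_mul _ _ _ _ (e _) (e _), CExt.mm_io]
  · rw [← CExt.mm_mul _ _ _ _ (e _) (e _), ← CExt.mm_pow _ _ (e2 _ _), h.r12, h'.r12, CExt.mm_io]
  · have e3 : (t 0 * t 1 * t 2).g = (t' 0 * t' 1 * t' 2).g := by
      rw [CExt.mul_g, e2, e, ← CExt.mul_g]
    have e4 : (t 0 * t 1 * t 2 * t 3).g = (t' 0 * t' 1 * t' 2 * t' 3).g := by
      rw [CExt.mul_g, e3, e, ← CExt.mul_g]
    rw [← CExt.mm_mul _ _ _ _ (e _) (e _), ← CExt.mm_mul _ _ _ _ (e2 _ _) (e _),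
      ← CExt.mm_mul _ _ _ _ e3 (e _), ← CExt.mm_pow _ _ e4, h.cox, h'.cox, CExt.mm_io]

/-- A coboundary has trivial invariants. -/
theorem Lift.of_coboundary {Γ : Type} [Group Γ] {s : Fin 4 → Γ} {σ : Z2 ℂ Γ} {t : Fin 4 → CExt σ}
    {b c d : ℂˣ} (h : Lift s σ t b c d) (hσ : IsCoboundary ℂ Γ σ.1) : c = 1 ∧ d = 1 := by
  obtain ⟨γ, h1, hγ⟩ := hσ
  let ρ : CExt σ →* ℂˣ :=
    { toFun := fun x => x.a * γ x.g
      map_one' := by simp [CExt.one_a, CExt.one_g, h1]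
      map_mul' := fun x y => by
        rw [CExt.mul_a, CExt.mul_g, hγ]
        calc _ = x.a * y.a * γ x.g * γ y.g * ((γ (x.g * y.g))⁻¹ * γ (x.g * y.g)) := by ac_rfl
          _ = _ := by rw [inv_mul_cancel, mul_one]; ac_rfl }
  have hρ : ∀ a, ρ (CExt.io a) = a := fun a => by
    change a * γ 1 = a
    rw [h1, mul_one]
  constructor
  · have := congrArg ρ h.c02
    rw [map_mul, map_mul, map_mul, hρ, mul_comm (ρ (t 2))] at this
    exact (mul_eq_right.mp this.symm)
  · have := congrArg ρ h.cox
    have hs : ∀ i, ρ (t i) ^ 2 = 1 := fun i => by rw [← map_pow, pow_two, h.sq, map_one]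
    have hs6 : ∀ i, ρ (t i) ^ 6 = 1 := fun i => by
      rw [show 6 = 2 * 3 from rfl, pow_mul, hs, one_pow]
    rw [map_pow, map_mul, map_mul, map_mul, mul_pow, mul_pow, mul_pow, hρ, hs6, hs6, hs6, hs6] at this
    simpa using this.symm

/-- from `(ab)^3=1` to the braid relation -/
theorem braid3 {E : Type*} [Group E] {a b : E} (ha : a * a = 1) (hb : b * b = 1)
    (h : (a * b) ^ 3 = 1) (x : E) : b * (a * (b * x)) = a * (b * (a * x)) := by
  have ea : a⁻¹ = a := inv_eq_of_mul_eq_one_left ha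
  have eb : b⁻¹ = b := inv_eq_of_mul_eq_one_left hb
  have h' : (a * b * a) * (b * a * b) = 1 := by rw [← h, pow_succ, pow_two]; simp only [mul_assoc]
  have h2 := eq_inv_of_mul_eq_one_left h'
  simp only [mul_inv_rev, ea, eb, mul_assoc] at h2
  have := congrArg (fun y => y * x) h2
  simp only [mul_assoc] at this
  exact this.symm

theorem braid4 {E : Type*} [Group E] {a b z : E} (ha : a * a = 1) (hb : b * b = 1)
    (hz : ∀ x, z * x = x * z) (hzz : z * z = 1)
    (h : (a * b) ^ 4 = z) (x : E) : b * (a * (b * (a * x))) = z * (a * (b * (a * (b * x)))) := by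
  have ea : a⁻¹ = a := inv_eq_of_mul_eq_one_left ha
  have eb : b⁻¹ = b := inv_eq_of_mul_eq_one_left hb
  have h' : (z * (a * b * a * b)) * (a * b * a * b) = 1 := by
    rw [mul_assoc, ← hzz]
    congr 1
    rw [← h]
    simp only [pow_succ, pow_zero, one_mul, mul_assoc]
  have h2 := eq_inv_of_mul_eq_one_left h'
  simp only [mul_inv_rev, ea, eb, mul_assoc] at h2
  have := congrArg (fun y => y * x) h2
  simp only [mul_assoc] at this
  exact this.symm

theorem sq_of_dihedral {E : Type*} [Group E] {a b z : E} (ha : a * a = 1) (hb : b * b = 1)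
    (hz : ∀ x, z * x = x * z) (n : ℕ) (h : (a * b) ^ n = z) : z * z = 1 := by
  have ea : a⁻¹ = a := inv_eq_of_mul_eq_one_left ha
  have eb : b⁻¹ = b := inv_eq_of_mul_eq_one_left hb
  have e1 : a * (a * b) * a⁻¹ = (a * b)⁻¹ := by
    rw [mul_inv_rev, ea, eb, ← mul_assoc, ha, one_mul]
  have e2 : (a * (a * b) * a⁻¹) ^ n = a * (a * b) ^ n * a⁻¹ := conj_pow
  rw [e1, inv_pow, h, ← hz, mul_inv_cancel_right] at e2
  rw [← e2]
  nth_rewrite 2 [e2]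
  simp

theorem sq_of_comm {E : Type*} [Group E] {a b z : E} (ha : a * a = 1)
    (hz : ∀ x, z * x = x * z) (h : a * b = z * (b * a)) : z * z = 1 := by
  have h2 : a * (a * b) = z * z * b := by
    rw [h, ← mul_assoc, ← hz, mul_assoc, ← mul_assoc a b a, h]
    simp only [mul_assoc, ha, mul_one]
  rw [← mul_assoc, ha] at h2
  exact (mul_right_cancel h2).symm

theorem comm_eq {E : Type*} [Group E] {a b x z w : E} (hb : ∀ x : E, b * (a * (b * x)) = a * (b * (a * x)))
    (hz : ∀ x, z * x = x * z) (hw : ∀ x, w * x = x * w)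
    (h : a * x = z * (x * a)) (h' : b * x = w * (x * b)) : z = w := by
  have hz2 : ∀ p q : E, p * (z * q) = z * (p * q) := fun p q => by
    rw [← mul_assoc, ← hz, mul_assoc]
  have hw2 : ∀ p q : E, p * (w * q) = w * (p * q) := fun p q => by
    rw [← mul_assoc, ← hw, mul_assoc]
  have ha : ∀ y, a * (x * y) = z * (x * (a * y)) := fun y => by
    rw [← mul_assoc, h]; simp only [mul_assoc]
  have hbx : ∀ y, b * (x * y) = w * (x * (b * y)) := fun y => by
    rw [← mul_assoc, h']; simp only [mul_assoc]
  have e := hb (x * 1)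
  simp only [ha, hbx, hw2 a, hw2 b, hw2 x, hz2 a, hz2 b, hz2 x] at e
  rw [hb] at e
  simp only [← mul_assoc] at e
  have := mul_right_cancel (mul_right_cancel (mul_right_cancel (mul_right_cancel (mul_right_cancel e))))
  rw [hw z] at this
  exact (mul_left_cancel this).symm

theorem cox_sq {E : Type*} [Group E] {a b p q z c : E} (ha : a * a = 1) (hb : b * b = 1)
    (hp : p * p = 1) (hq : q * q = 1) (hz : ∀ x, z * x = x * z) (hc : ∀ x, c * x = x * c)
    (h02 : a * p = c * (p * a)) (h03 : a * q = c * (q * a)) (h13 : b * q = c * (q * b))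
    (h : (a * b * p * q) ^ 6 = z) : z * z = 1 := by
  have ea : a⁻¹ = a := inv_eq_of_mul_eq_one_left ha
  have eb : b⁻¹ = b := inv_eq_of_mul_eq_one_left hb
  have ep : p⁻¹ = p := inv_eq_of_mul_eq_one_left hp
  have eq : q⁻¹ = q := inv_eq_of_mul_eq_one_left hq
  have hcc : c * c = 1 := sq_of_comm ha hc h02
  have hcc' : ∀ x, c * (c * x) = x := fun x => by rw [← mul_assoc, hcc, one_mul]
  have hc2 : ∀ p q : E, p * (c * q) = c * (p * q) := fun p q => by
    rw [← mul_assoc, ← hc, mul_assoc]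
  have k1 : ∀ x, a * (p * (q * x)) = p * (q * (a * x)) := fun x => by
    rw [← mul_assoc a, h02]
    simp only [mul_assoc]
    rw [← mul_assoc a q, h03]
    simp only [mul_assoc, hc2 p, hcc']
  have k2 : ∀ x, b * (a * (q * x)) = q * (b * (a * x)) := fun x => by
    rw [← mul_assoc a, h03]
    simp only [mul_assoc, hc2 b]
    rw [← mul_assoc b q, h13]
    simp only [mul_assoc, hcc']
  have qq : ∀ x, q * (q * x) = x := fun x => by rw [← mul_assoc, hq, one_mul]
  have pp : ∀ x, p * (p * x) = x := fun x => by rw [← mul_assoc, hp, one_mul]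
  have bb : ∀ x, b * (b * x) = x := fun x => by rw [← mul_assoc, hb, one_mul]
  have aa : ∀ x, a * (a * x) = x := fun x => by rw [← mul_assoc, ha, one_mul]
  have key : (q * (p * q) * b * (p * q)) * (a * b * p * q) * (q * (p * q) * b * (p * q))⁻¹
      = (a * b * p * q)⁻¹ := by
    simp only [mul_inv_rev, ea, eb, ep, eq, mul_assoc, qq, pp]
    -- q p q b p q a b b q p q = q p b a
    rw [← k1]
    simp only [bb, qq, pp]
    have := k2 1
    simp only [mul_one] at this
    simp only [this, qq, pp, hq, mul_one]
  have e2 := conj_pow (i := 6) (a := q * (p * q) * b * (p * q)) (b := a * b * p * q)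
  rw [key, inv_pow, h, ← hz, mul_inv_cancel_right] at e2
  nth_rewrite 1 [← e2]
  simp

theorem units_pm {a : ℂˣ} (h : a * a = 1) : a = 1 ∨ a = -1 := by
  have h2 : (a : ℂ) * a = 1 := by rw [← Units.val_mul, h, Units.val_one]
  rcases mul_self_eq_one_iff.mp h2 with h | h
  · left; ext; simpa using h
  · right; ext; simpa using h

theorem exists_unit_sqrt (y : ℂˣ) : ∃ x : ℂˣ, x * x * y = 1 := by
  obtain ⟨x, hx⟩ := IsAlgClosed.exists_pow_nat_eq ((y⁻¹ : ℂˣ) : ℂ) (n := 2) (by norm_num)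
  have hx0 : x ≠ 0 := by
    rintro rfl
    rw [zero_pow (by norm_num)] at hx
    exact (y⁻¹).ne_zero hx.symm
  refine ⟨Units.mk0 x hx0, ?_⟩
  have : Units.mk0 x hx0 * Units.mk0 x hx0 = y⁻¹ := by
    ext
    rw [← hx, pow_two]; rfl
  rw [this, inv_mul_cancel]

section lifts
variable {Γ : Type} [Group Γ] {s : Fin 4 → Γ}

theorem CExt.io_one {σ : Z2 ℂ Γ} : (CExt.io 1 : CExt σ) = 1 := map_one _

theorem CExt.io_sq {σ : Z2 ℂ Γ} {a : ℂˣ} (h : (CExt.io a : CExt σ) * CExt.io a = 1) : a * a = 1 := by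
  rw [← map_mul, ← CExt.io_one] at h
  exact CExt.io_inj h

/-- multiply an involution by a scalar to normalise a braid relation -/
theorem fix3 {σ : Z2 ℂ Γ} (x y : CExt σ) (hx : x * x = 1) (hy : y * y = 1)
    (h : (CExt.pr x * CExt.pr y) ^ 3 = 1) :
    ∃ a : ℂˣ, (CExt.io a * x) * (CExt.io a * x) = 1 ∧ (CExt.io a * x * y) ^ 3 = 1 := by
  obtain ⟨a, ha⟩ := CExt.eq_io ((x * y) ^ 3) (by rw [map_pow, map_mul, h])
  have haa := CExt.io_sq (sq_of_dihedral hx hy (CExt.io_comm a) 3 ha)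
  refine ⟨a, ?_, ?_⟩
  · rw [mul_assoc, ← mul_assoc x, ← CExt.io_comm, mul_assoc, hx, mul_one, ← map_mul, haa, map_one]
  · rw [mul_assoc, (show Commute (CExt.io a) (x * y) from CExt.io_comm a _).mul_pow, ha,
      ← map_pow, ← map_mul]
    rw [show a ^ 3 * a = (a * a) * (a * a) by rw [pow_succ, pow_two]; ac_rfl, haa, one_mul, map_one]

theorem exists_scalar_comm {σ : Z2 ℂ Γ} (x y : CExt σ) (h : CExt.pr x * CExt.pr y = CExt.pr y * CExt.pr x) :
    ∃ c : ℂˣ, x * y = CExt.io c * (y * x) := by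
  obtain ⟨c, hc⟩ := CExt.eq_io (x * y * (y * x)⁻¹) (by
    rw [map_mul, map_mul, map_inv, map_mul, h, mul_inv_cancel])
  exact ⟨c, by rw [← hc, inv_mul_cancel_right]⟩

theorem exists_lift (hs : F4Rel s) (hs6 : (s 0 * s 1 * s 2 * s 3) ^ 6 = 1) (σ : Z2 ℂ Γ) :
    ∃ t b c d, Lift s σ t b c d := by
  have hex : ∀ i, ∃ t : CExt σ, t.g = s i ∧ t * t = 1 := fun i => by
    obtain ⟨x, hx⟩ := exists_unit_sqrt (σ.1 (s i) (s i))
    refine ⟨⟨x, s i⟩, rfl, ?_⟩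
    ext1
    · exact hx
    · exact hs.sq i
  choose p hp hpp using hex
  have hpr : ∀ i, CExt.pr (p i) = s i := hp
  obtain ⟨a, ha, ha3⟩ := fix3 (p 0) (p 1) (hpp 0) (hpp 1) (by rw [hpr, hpr, hs.r01])
  have hr : (s 3 * s 2) ^ 3 = 1 := by
    have e : s 3 * s 2 = (s 2 * s 3)⁻¹ := by
      rw [mul_inv_rev, inv_eq_of_mul_eq_one_left (hs.sq 2), inv_eq_of_mul_eq_one_left (hs.sq 3)]
    rw [e, inv_pow, hs.r23, inv_one]
  obtain ⟨b, hb, hb3⟩ := fix3 (p 3) (p 2) (hpp 3) (hpp 2) (by rw [hpr, hpr, hr])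
  set t0 := CExt.io a * p 0 with ht0
  set t3 := CExt.io b * p 3 with ht3
  have pr0 : CExt.pr t0 = s 0 := by rw [ht0, map_mul, CExt.pr_io, one_mul, hpr]
  have pr3 : CExt.pr t3 = s 3 := by rw [ht3, map_mul, CExt.pr_io, one_mul, hpr]
  have hb3' : (p 2 * t3) ^ 3 = 1 := by
    have e : p 2 * t3 = (t3 * p 2)⁻¹ := by
      rw [mul_inv_rev, inv_eq_of_mul_eq_one_left (hpp 2), inv_eq_of_mul_eq_one_left hb]
    rw [e, inv_pow, hb3, inv_one]
  obtain ⟨c, hc02⟩ := exists_scalar_comm t0 (p 2) (by rw [pr0, hpr, hs.c02])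
  obtain ⟨c', hc03⟩ := exists_scalar_comm t0 t3 (by rw [pr0, pr3, hs.c03])
  obtain ⟨c'', hc13⟩ := exists_scalar_comm (p 1) t3 (by rw [pr3, hpr, hs.c13])
  obtain ⟨e, he⟩ := CExt.eq_io ((p 1 * p 2) ^ 4) (by rw [map_pow, map_mul, hpr, hpr, hs.r12])
  obtain ⟨d, hd⟩ := CExt.eq_io ((t0 * p 1 * p 2 * t3) ^ 6) (by
    rw [map_pow, map_mul, map_mul, map_mul, hpr, hpr, pr0, pr3, hs6])
  have e1 : c' = c'' := CExt.io_inj (comm_eq (braid3 ha (hpp 1) ha3) (CExt.io_comm _)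
    (CExt.io_comm _) hc03 hc13)
  have flip : ∀ (x y : CExt σ) (c : ℂˣ), x * y = CExt.io c * (y * x) →
      y * x = CExt.io c⁻¹ * (x * y) := fun x y c h => by
    rw [h, ← mul_assoc, ← map_mul, inv_mul_cancel, map_one, one_mul]
  have e2 : c = c' := by
    have := CExt.io_inj (comm_eq (braid3 (hpp 2) hb hb3') (CExt.io_comm _)
      (CExt.io_comm _) (flip _ _ _ hc02) (flip _ _ _ hc03))
    exact inv_injective this
  subst e1
  subst e2
  refine ⟨![t0, p 1, p 2, t3], e, c, d, ?_, ?_, ha3, hb3', hc02, hc03, hc13, he, hd⟩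
  · intro i; fin_cases i
    · exact pr0
    · exact hp 1
    · exact hp 2
    · exact pr3
  · intro i; fin_cases i
    · exact ha
    · exact hpp 1
    · exact hpp 2
    · exact hb

theorem Lift.c_sq {σ : Z2 ℂ Γ} {t : Fin 4 → CExt σ} {b c d : ℂˣ} (h : Lift s σ t b c d) :
    c * c = 1 := CExt.io_sq (sq_of_comm (h.sq 0) (CExt.io_comm c) h.c02)

theorem Lift.d_sq {σ : Z2 ℂ Γ} {t : Fin 4 → CExt σ} {b c d : ℂˣ} (h : Lift s σ t b c d) :
    d * d = 1 := CExt.io_sq (cox_sq (h.sq 0) (h.sq 1) (h.sq 2) (h.sq 3) (CExt.io_comm d)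
      (CExt.io_comm c) h.c02 h.c03 h.c13 h.cox)

theorem Lift.b_one {σ : Z2 ℂ Γ} {t : Fin 4 → CExt σ} {b d : ℂˣ} (h : Lift s σ t b 1 d) :
    b = 1 := by
  have hbb := sq_of_dihedral (h.sq 1) (h.sq 2) (CExt.io_comm b) 4 h.r12
  have hz : ∀ (y x : CExt σ), y * (CExt.io b * x) = CExt.io b * (y * x) := fun y x => by
    rw [← mul_assoc, ← CExt.io_comm, mul_assoc]
  have sq : ∀ i (x : CExt σ), t i * (t i * x) = x := fun i x => by
    rw [← mul_assoc, h.sq, one_mul]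
  have cm : ∀ {p q : CExt σ}, p * q = CExt.io 1 * (q * p) → ∀ x, q * (p * x) = p * (q * x) := by
    intro p q e x
    rw [map_one, one_mul] at e
    rw [← mul_assoc, ← e, mul_assoc]
  have := f4_key (t 0) (t 1) (t 2) (t 3) (CExt.io b) (hz _) (hz _) (hz _) (hz _)
    (fun x => by rw [← mul_assoc, hbb, one_mul]) (sq 0) (sq 1) (sq 2) (sq 3)
    (braid3 (h.sq 0) (h.sq 1) h.r01) (braid3 (h.sq 2) (h.sq 3) h.r23)
    (cm h.c02) (cm h.c03) (cm h.c13)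
    (braid4 (h.sq 1) (h.sq 2) (CExt.io_comm b) hbb h.r12)
    (by rw [h.cox, CExt.io_comm])
  exact CExt.io_inj (this.trans CExt.io_one.symm)

theorem Lift.coboundary
    (huniv : ∀ (H : Type) [Group H] (t : Fin 4 → H), F4Rel t → (t 0 * t 1 * t 2 * t 3) ^ 6 = 1 →
      ∃ φ : Γ →* H, ∀ i, φ (s i) = t i)
    (hext : ∀ φ : Γ →* Γ, (∀ i, φ (s i) = s i) → φ = MonoidHom.id Γ)
    {σ : Z2 ℂ Γ} {t : Fin 4 → CExt σ} {b : ℂˣ} (h : Lift s σ t b 1 1) :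
    σ ∈ B2 ℂ Γ := by
  have hb := h.b_one
  subst hb
  have cm : ∀ {p q : CExt σ}, p * q = CExt.io 1 * (q * p) → p * q = q * p := by
    intro p q e
    rwa [map_one, one_mul] at e
  obtain ⟨φ, hφ⟩ := huniv (CExt σ) t ⟨h.sq, h.r01, h.r23, cm h.c02, cm h.c03, cm h.c13,
    h.r12.trans CExt.io_one⟩ (h.cox.trans CExt.io_one)
  have hid := hext (CExt.pr.comp φ) (fun i => by
    rw [MonoidHom.comp_apply, hφ]; exact h.proj i)
  have hg : ∀ g, (φ g).g = g := fun g => DFunLike.congr_fun hid g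
  refine ⟨fun g => (φ g).a⁻¹, by simp [CExt.one_a], fun g h => ?_⟩
  have e := congrArg CExt.a (map_mul φ g h)
  rw [CExt.mul_a, hg, hg] at e
  simp only [inv_inv, e]
  calc σ.1 g h = ((φ g).a⁻¹ * (φ g).a) * ((φ h).a⁻¹ * (φ h).a) * σ.1 g h := by simp
    _ = _ := by ac_rfl

/-- The cup product cocycle. -/
theorem exists_alpha (hs : F4Rel s)
    (huniv : ∀ (H : Type) [Group H] (t : Fin 4 → H), F4Rel t → (t 0 * t 1 * t 2 * t 3) ^ 6 = 1 →
      ∃ φ : Γ →* H, ∀ i, φ (s i) = t i) (hs6 : (s 0 * s 1 * s 2 * s 3) ^ 6 = 1) :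
    ∃ (α : Z2 ℂ Γ) (t : _) (b d : _), Lift s α t b (-1) d := by
  obtain ⟨e1, he1⟩ := huniv (Multiplicative (ZMod 2)) (fun i => Multiplicative.ofAdd (![1, 1, 0, 0] i))
    (by constructor <;> decide) (by decide)
  obtain ⟨e2, he2⟩ := huniv (Multiplicative (ZMod 2)) (fun i => Multiplicative.ofAdd (![0, 0, 1, 1] i))
    (by constructor <;> decide) (by decide)
  let f : Multiplicative (ZMod 2) → Multiplicative (ZMod 2) → ℂˣ := fun x y =>
    if x = 1 then 1 else if y = 1 then 1 else -1
  have f1 : ∀ y, f 1 y = 1 := fun y => by simp [f]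
  have f2 : ∀ y, f y 1 = 1 := fun y => by simp [f]
  have cases2 : ∀ x : Multiplicative (ZMod 2), x = 1 ∨ x = Multiplicative.ofAdd 1 := by decide
  have hne : (Multiplicative.ofAdd 1 : Multiplicative (ZMod 2)) ≠ 1 := by decide
  have hmm : (Multiplicative.ofAdd 1 : Multiplicative (ZMod 2)) * Multiplicative.ofAdd 1 = 1 := by decide
  have f3 : ∀ x y z, f (x * y) z = f x z * f y z := by
    intro x y z
    rcases cases2 x with rfl | rfl <;> rcases cases2 y with rfl | rfl <;>
      rcases cases2 z with rfl | rfl <;> simp [f, hne, hmm]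
  have f4 : ∀ x y z, f x (y * z) = f x y * f x z := by
    intro x y z
    rcases cases2 x with rfl | rfl <;> rcases cases2 y with rfl | rfl <;>
      rcases cases2 z with rfl | rfl <;> simp [f, hne, hmm]
  let α : Z2 ℂ Γ := ⟨fun g h => f (e1 g) (e2 h), by
    refine ⟨fun g h l => ?_, fun g => ?_, fun g => ?_⟩
    · simp only [map_mul, f3, f4]; ac_rfl
    · simp only [map_one, f1]
    · simp only [map_one, f2]⟩
  obtain ⟨t, b, c, d, h⟩ := exists_lift hs hs6 α
  refine ⟨α, t, b, d, ?_⟩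
  have hc : c = -1 := by
    have e := congrArg CExt.a h.c02
    rw [CExt.mul_a, CExt.mul_a, CExt.mul_a, h.proj, h.proj] at e
    have a02 : α.1 (s 0) (s 2) = -1 := by
      change f (e1 (s 0)) (e2 (s 2)) = -1
      rw [he1, he2]
      exact (if_neg hne).trans (if_neg hne)
    have a20 : α.1 (s 2) (s 0) = 1 := by
      change f (e1 (s 2)) (e2 (s 0)) = 1
      rw [he1]
      exact f1 _
    rw [a02, a20] at e
    change _ = c * ((t 2).a * (t 0).a * 1) * α.1 1 _ at e
    rw [α.2.2.1, mul_one, mul_one, mul_comm (t 0).a, mul_comm] at e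
    exact (mul_right_cancel e).symm
  rw [← hc]
  exact h

/-- The inflated class. -/
theorem exists_beta {W : Type} [Group W] (π : W →* Γ) (hπ : Function.Surjective π) (u : W)
    (hu1 : u ≠ 1) (huu : u * u = 1) (hcen : ∀ w, u * w = w * u)
    (hker : ∀ w, π w = 1 → w = 1 ∨ w = u) (hπu : π u = 1) (r : Fin 4 → W) (hr : F4Rel r)
    (hru : (r 0 * r 1 * r 2 * r 3) ^ 6 = u) :
    ∃ (β : Z2 ℂ Γ) (t : _), Lift (fun i => π (r i)) β t 1 1 (-1) := by
  classical
  obtain ⟨q, hq⟩ : ∃ q : Γ → W, ∀ g, π (q g) = g := ⟨_, Function.surjInv_eq hπ⟩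
  let v : Γ → W := fun g => if g = 1 then 1 else q g
  have hv : ∀ g, π (v g) = g := fun g => by
    by_cases h : g = 1
    · simp [v, h]
    · simp [v, h, hq]
  have hv1 : v 1 = 1 := by simp [v]
  let sg : W → ℂˣ := fun w => if w = 1 then 1 else -1
  have sg1 : sg 1 = 1 := if_pos rfl
  have sgu : sg u = -1 := if_neg hu1
  have sgm : ∀ x y, π x = 1 → π y = 1 → sg (x * y) = sg x * sg y := by
    intro x y hx hy
    rcases hker x hx with rfl | rfl <;> rcases hker y hy with rfl | rfl
    · simp [sg1]
    · simp [sg1]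
    · simp [sg1]
    · rw [huu, sg1, sgu]; simp
  have kc : ∀ x, π x = 1 → ∀ w, x * w = w * x := by
    intro x hx w
    rcases hker x hx with rfl | rfl
    · simp
    · exact hcen w
  have k1 : ∀ g h, π (v g * v h * (v (g * h))⁻¹) = 1 := fun g h => by
    rw [map_mul, map_mul, map_inv, hv, hv, hv, mul_inv_cancel]
  let β : Z2 ℂ Γ := ⟨fun g h => sg (v g * v h * (v (g * h))⁻¹), by
    refine ⟨fun g h l => ?_, fun g => ?_, fun g => ?_⟩
    · simp only []
      rw [← sgm _ _ (k1 _ _) (k1 _ _), ← sgm _ _ (k1 _ _) (k1 _ _)]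
      congr 1
      rw [mul_assoc (v g) (v (h * l)), ← mul_assoc _ (v g), kc (v h * v l * (v (h * l))⁻¹) (k1 _ _) (v g)]
      group
    · simp [hv1, sg1]
    · simp [hv1, sg1]⟩
  have k2 : ∀ w, π (w * (v (π w))⁻¹) = 1 := fun w => by
    rw [map_mul, map_inv, hv, mul_inv_cancel]
  let ψ : W →* CExt β :=
    { toFun := fun w => ⟨sg (w * (v (π w))⁻¹), π w⟩
      map_one' := by
        ext1
        · simp [hv1, sg1, CExt.one_a]
        · simp [CExt.one_g]
      map_mul' := fun w w' => by
        ext1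
        · rw [CExt.mul_a]
          change sg (w * w' * (v (π (w * w')))⁻¹) = sg (w * (v (π w))⁻¹) * sg (w' * (v (π w'))⁻¹) *
            sg (v (π w) * v (π w') * (v (π w * π w'))⁻¹)
          rw [mul_assoc (sg _) (sg _) (sg _), ← sgm _ _ (k2 w') (k1 _ _), ← sgm _ _ (k2 w)]
          · congr 1
            rw [map_mul, mul_assoc (v (π w)), ← mul_assoc (w' * (v (π w'))⁻¹),
              kc (w' * (v (π w'))⁻¹) (k2 w')]
            group
          · rw [map_mul, k2, k1, one_mul]
        · rw [CExt.mul_g]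
          exact map_mul π w w' }
  have hψ : ∀ {x y : W}, x * y = y * x → ψ x * ψ y = CExt.io 1 * (ψ y * ψ x) := by
    intro x y h
    rw [map_one, one_mul, ← map_mul, ← map_mul, h]
  refine ⟨β, fun i => ψ (r i), fun i => rfl, fun i => ?_, ?_, ?_, hψ hr.c02, hψ hr.c03, hψ hr.c13, ?_, ?_⟩
  · rw [← map_mul, hr.sq, map_one]
  · rw [← map_mul, ← map_pow, hr.r01, map_one]
  · rw [← map_mul, ← map_pow, hr.r23, map_one]
  · rw [← map_mul, ← map_pow, hr.r12, map_one, map_one]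
  · rw [← map_mul, ← map_mul, ← map_mul, ← map_pow, hru]
    ext1
    · change sg (u * (v (π u))⁻¹) = -1
      rw [hπu, hv1, inv_one, mul_one, sgu]
    · exact hπu

end lifts

theorem klein_of {Q : Type} [CommGroup Q] (A B : Q) (hA : A ≠ 1) (hB : B ≠ 1) (hAB : A * B ≠ 1)
    (hAA : A * A = 1) (hBB : B * B = 1) (hall : ∀ x : Q, x = 1 ∨ x = A ∨ x = B ∨ x = A * B) :
    Nonempty (Q ≃* Multiplicative (ZMod 2 × ZMod 2)) := by
  classical
  have hne : A ≠ B := fun h => hAB (by rw [← h, hAA])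
  have hcard : Nat.card Q = 4 := by
    have e : (Set.univ : Set Q) = (({1, A, B, A * B} : Finset Q) : Set Q) := by
      ext x
      simpa using hall x
    rw [← Set.ncard_univ, e, Set.ncard_coe_finset]
    rw [Finset.card_insert_of_notMem, Finset.card_insert_of_notMem, Finset.card_insert_of_notMem,
      Finset.card_singleton]
    · simpa using hA
    · simpa using ⟨hne, hB⟩
    · simpa using ⟨hA.symm, hB.symm, hAB.symm⟩
  have hexp : Monoid.exponent Q = 2 := by
    have hd : Monoid.exponent Q ∣ 2 := Monoid.exponent_dvd_of_forall_pow_eq_one (fun x => by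
      rw [pow_two]
      rcases hall x with rfl | rfl | rfl | rfl
      · simp
      · exact hAA
      · exact hBB
      · rw [mul_mul_mul_comm, hAA, hBB, one_mul])
    rcases (Nat.dvd_prime Nat.prime_two).mp hd with h | h
    · exfalso
      have := Monoid.pow_exponent_eq_one A
      rw [h, pow_one] at this
      exact hA this
    · exact h
  haveI : IsKleinFour Q := ⟨hcard, hexp⟩
  exact IsKleinFour.nonempty_mulEquiv

theorem eq_of_mul_one {Q : Type} [Group Q] {x y : Q} (h : x * y = 1) (h' : y * y = 1) : x = y :=
  mul_right_cancel (h.trans h'.symm)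

theorem f4_abstract {Γ W : Type} [Group Γ] [Group W] (π : W →* Γ) (hπ : Function.Surjective π) (u : W)
    (hu1 : u ≠ 1) (huu : u * u = 1) (hcen : ∀ w, u * w = w * u)
    (hker : ∀ w, π w = 1 → w = 1 ∨ w = u) (hπu : π u = 1) (r : Fin 4 → W) (hr : F4Rel r)
    (hru : (r 0 * r 1 * r 2 * r 3) ^ 6 = u)
    (huniv : ∀ (H : Type) [Group H] (t : Fin 4 → H), F4Rel t → (t 0 * t 1 * t 2 * t 3) ^ 6 = 1 →
      ∃ φ : Γ →* H, ∀ i, φ (π (r i)) = t i)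
    (hext : ∀ φ : Γ →* Γ, (∀ i, φ (π (r i)) = π (r i)) → φ = MonoidHom.id Γ) :
    Nonempty (H2 ℂ Γ ≃* Multiplicative (ZMod 2 × ZMod 2)) := by
  have hs : F4Rel (fun i => π (r i)) := by
    refine ⟨fun i => ?_, ?_, ?_, ?_, ?_, ?_, ?_⟩ <;> simp only [← map_mul, ← map_pow]
    · rw [hr.sq, map_one]
    · rw [hr.r01, map_one]
    · rw [hr.r23, map_one]
    · rw [hr.c02]
    · rw [hr.c03]
    · rw [hr.c13]
    · rw [hr.r12, map_one]
  have hs6 : (π (r 0) * π (r 1) * π (r 2) * π (r 3)) ^ 6 = 1 := by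
    rw [← map_mul, ← map_mul, ← map_mul, ← map_pow, hru, hπu]
  obtain ⟨α, tα, bα, dα, hα⟩ := exists_alpha hs huniv hs6
  obtain ⟨β, tβ, hβ⟩ := exists_beta π hπ u hu1 huu hcen hker hπu r hr hru
  have hm1 : (-1 : ℂˣ) ≠ 1 := by
    intro h
    have := congrArg (fun x : ℂˣ => (x : ℂ)) h
    norm_num at this
  have mk1 : ∀ σ : Z2 ℂ Γ, (QuotientGroup.mk σ : H2 ℂ Γ) = 1 ↔ σ ∈ B2 ℂ Γ := fun σ =>
    QuotientGroup.eq_one_iff σ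
  have sqr : ∀ {σ : Z2 ℂ Γ} {t b c d}, Lift (fun i => π (r i)) σ t b c d → σ * σ ∈ B2 ℂ Γ := by
    intro σ t b c d h
    have := h.mul h
    rw [h.c_sq, h.d_sq] at this
    exact this.coboundary huniv hext
  have cls : ∀ {σ τ : Z2 ℂ Γ} {t b t' b' c d}, Lift (fun i => π (r i)) σ t b c d →
      Lift (fun i => π (r i)) τ t' b' c d → (QuotientGroup.mk σ : H2 ℂ Γ) = QuotientGroup.mk τ := by
    intro σ τ t b t' b' c d h h'
    have e1 := h.mul h'
    rw [h.c_sq, h.d_sq] at e1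
    have e1 := (mk1 _).mpr (e1.coboundary huniv hext)
    have e2 := (mk1 _).mpr (sqr h')
    rw [QuotientGroup.mk_mul] at e1 e2
    exact eq_of_mul_one e1 e2
  have non : ∀ {σ : Z2 ℂ Γ} {t b c d}, Lift (fun i => π (r i)) σ t b c d → (c ≠ 1 ∨ d ≠ 1) →
      (QuotientGroup.mk σ : H2 ℂ Γ) ≠ 1 := by
    intro σ t b c d h hcd e
    have := h.of_coboundary ((mk1 _).mp e)
    tauto
  have hαβ := hα.mul hβ
  refine klein_of (QuotientGroup.mk α : H2 ℂ Γ) (QuotientGroup.mk β) ?_ ?_ ?_ ?_ ?_ ?_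
  · exact non hα (Or.inl hm1)
  · exact non hβ (Or.inr hm1)
  · exact non hαβ (Or.inl (by rw [mul_one]; exact hm1))
  · exact (mk1 _).mpr (sqr hα)
  · exact (mk1 _).mpr (sqr hβ)
  · intro x
    obtain ⟨σ, rfl⟩ := QuotientGroup.mk_surjective x
    obtain ⟨t, b, c, d, h⟩ := exists_lift hs hs6 σ
    have mm1 : (-1 : ℂˣ) * -1 = 1 := by simp
    rcases units_pm h.c_sq with rfl | rfl <;> rcases units_pm h.d_sq with rfl | rfl <;>
      rcases units_pm hα.d_sq with hd | hd <;> rw [hd] at hα hαβ <;>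
      simp only [mul_one, one_mul, mm1] at hαβ
    · exact Or.inl ((mk1 _).mpr (h.coboundary huniv hext))
    · exact Or.inl ((mk1 _).mpr (h.coboundary huniv hext))
    · exact Or.inr (Or.inr (Or.inl (cls h hβ)))
    · exact Or.inr (Or.inr (Or.inl (cls h hβ)))
    · exact Or.inr (Or.inl (cls h hα))
    · exact Or.inr (Or.inr (Or.inr (cls h hαβ)))
    · exact Or.inr (Or.inr (Or.inr (cls h hαβ)))
    · exact Or.inr (Or.inl (cls h hα))

/-- The simple reflections acting on the root lattice. -/
def f4Mat : Fin 4 → Matrix (Fin 4) (Fin 4) ℤ :=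
  ![!![-1, 1, 0, 0; 0, 1, 0, 0; 0, 0, 1, 0; 0, 0, 0, 1],
    !![1, 0, 0, 0; 1, -1, 2, 0; 0, 0, 1, 0; 0, 0, 0, 1],
    !![1, 0, 0, 0; 0, 1, 0, 0; 0, 1, -1, 1; 0, 0, 0, 1],
    !![1, 0, 0, 0; 0, 1, 0, 0; 0, 0, 1, 0; 0, 0, 1, -1]]

theorem f4Mat_sq : ∀ i, f4Mat i * f4Mat i = 1 := by decide +kernel

/-- The reflections as units. -/
def f4Unit (i : Fin 4) : (Matrix (Fin 4) (Fin 4) ℤ)ˣ :=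
  ⟨f4Mat i, f4Mat i, f4Mat_sq i, f4Mat_sq i⟩

theorem f4Unit_rel : F4Rel f4Unit := by
  refine ⟨fun i => Units.ext (f4Mat_sq i), ?_, ?_, ?_, ?_, ?_, ?_⟩ <;> apply Units.ext
  · change (f4Mat 0 * f4Mat 1) ^ 3 = 1
    decide +kernel
  · change (f4Mat 2 * f4Mat 3) ^ 3 = 1
    decide +kernel
  · change f4Mat 0 * f4Mat 2 = f4Mat 2 * f4Mat 0
    decide +kernel
  · change f4Mat 0 * f4Mat 3 = f4Mat 3 * f4Mat 0
    decide +kernel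
  · change f4Mat 1 * f4Mat 3 = f4Mat 3 * f4Mat 1
    decide +kernel
  · change (f4Mat 1 * f4Mat 2) ^ 4 = 1
    decide +kernel

theorem f4Unit_cox : (f4Unit 0 * f4Unit 1 * f4Unit 2 * f4Unit 3) ^ 6 ≠ 1 := by
  intro h
  have h2 : (f4Mat 0 * f4Mat 1 * f4Mat 2 * f4Mat 3) ^ 6 = 1 := congrArg Units.val h
  revert h2
  decide +kernel

theorem coxS_rel (i j : Fin 4) : (coxS mF4 i * coxS mF4 j) ^ mF4 i j = 1 :=
  PresentedGroup.one_of_mem (rels := coxeterRels mF4)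
    (x := (FreeGroup.of i * FreeGroup.of j) ^ mF4 i j)
    (Set.mem_iUnion.mpr ⟨i, Set.mem_iUnion.mpr ⟨j, rfl⟩⟩)

theorem comm_of_sq {H : Type} [Group H] {a b : H} (ha : a * a = 1) (hb : b * b = 1)
    (h : (a * b) ^ 2 = 1) : a * b = b * a := by
  rw [pow_two] at h
  have := eq_inv_of_mul_eq_one_left h
  rwa [mul_inv_rev, inv_eq_of_mul_eq_one_left ha, inv_eq_of_mul_eq_one_left hb] at this

theorem coxS_f4 : F4Rel (coxS mF4) := by
  have sq : ∀ i, coxS mF4 i * coxS mF4 i = 1 := fun i => by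
    have := coxS_rel i i
    rwa [show mF4 i i = 1 by simp [mF4], pow_one] at this
  exact ⟨sq, coxS_rel 0 1, coxS_rel 2 3, comm_of_sq (sq 0) (sq 2) (coxS_rel 0 2),
    comm_of_sq (sq 0) (sq 3) (coxS_rel 0 3), comm_of_sq (sq 1) (sq 3) (coxS_rel 1 3), coxS_rel 1 2⟩

theorem rel_symm {H : Type} [Group H] {a b : H} (ha : a * a = 1) (hb : b * b = 1) (n : ℕ)
    (h : (a * b) ^ n = 1) : (b * a) ^ n = 1 := by
  have e : b * a = (a * b)⁻¹ := by
    rw [mul_inv_rev, inv_eq_of_mul_eq_one_left ha, inv_eq_of_mul_eq_one_left hb]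
  rw [e, inv_pow, h, inv_one]

theorem f4_univ {H : Type} [Group H] (t : Fin 4 → H) (h : F4Rel t) :
    ∃ φ : CoxGroup mF4 →* H, ∀ i, φ (coxS mF4 i) = t i := by
  have c2 : ∀ {a b : H}, a * a = 1 → b * b = 1 → a * b = b * a → (a * b) ^ 2 = 1 := by
    intro a b ha hb hab
    rw [pow_two]
    nth_rewrite 2 [hab]
    rw [mul_assoc, ← mul_assoc b, hb, one_mul, ha]
  have sq := h.sq
  have key : ∀ i j, (t i * t j) ^ mF4 i j = 1 := by
    have r02 := c2 (sq 0) (sq 2) h.c02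
    have r03 := c2 (sq 0) (sq 3) h.c03
    have r13 := c2 (sq 1) (sq 3) h.c13
    intro i j
    fin_cases i <;> fin_cases j
    · exact (pow_one _).trans (sq 0)
    · exact h.r01
    · exact r02
    · exact r03
    · exact rel_symm (sq 0) (sq 1) 3 h.r01
    · exact (pow_one _).trans (sq 1)
    · exact h.r12
    · exact r13
    · exact rel_symm (sq 0) (sq 2) 2 r02
    · exact rel_symm (sq 1) (sq 2) 4 h.r12
    · exact (pow_one _).trans (sq 2)
    · exact h.r23
    · exact rel_symm (sq 0) (sq 3) 2 r03
    · exact rel_symm (sq 1) (sq 3) 2 r13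
    · exact rel_symm (sq 2) (sq 3) 3 h.r23
    · exact (pow_one _).trans (sq 3)
  have hr : ∀ r ∈ coxeterRels mF4, FreeGroup.lift t r = 1 := by
    intro r hr
    obtain ⟨i, hr⟩ := Set.mem_iUnion.mp hr
    obtain ⟨j, hr⟩ := Set.mem_iUnion.mp hr
    rw [Set.mem_singleton_iff.mp hr, map_pow, map_mul, FreeGroup.lift_apply_of,
      FreeGroup.lift_apply_of]
    exact key i j
  exact ⟨PresentedGroup.toGroup hr, fun i => PresentedGroup.toGroup.of hr⟩

theorem coxProd_f4 : coxProd mF4 = coxS mF4 0 * coxS mF4 1 * coxS mF4 2 * coxS mF4 3 := by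
  simp [coxProd, List.ofFn_succ, mul_assoc]

/-- Let `W` be the Coxeter group of type `F₄` and `u = (s₁s₂s₃s₄)⁶` its longest element,
a central involution. Then `H²(W/⟨u⟩, ℂˣ) ≅ ℤ/2 × ℤ/2`. -/
theorem statement16 (u : CoxGroup mF4) (hu : u = coxProd mF4 ^ 6)
    (hcen : ∀ w, u * w = w * u) (h2 : u ^ 2 = 1)
    [hn : (Subgroup.zpowers u).Normal] :
    Nonempty (H2 ℂ (CoxGroup mF4 ⧸ Subgroup.zpowers u) ≃*
      Multiplicative (ZMod 2 × ZMod 2)) := by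
  have huu : u * u = 1 := by rw [← pow_two, h2]
  have hu' : (coxS mF4 0 * coxS mF4 1 * coxS mF4 2 * coxS mF4 3) ^ 6 = u := by
    rw [hu, coxProd_f4]
  have hu1 : u ≠ 1 := by
    obtain ⟨φ, hφ⟩ := f4_univ f4Unit f4Unit_rel
    intro h
    apply f4Unit_cox
    rw [← hφ 0, ← hφ 1, ← hφ 2, ← hφ 3, ← map_mul, ← map_mul, ← map_mul, ← map_pow, hu', h, map_one]
  refine f4_abstract (QuotientGroup.mk' (Subgroup.zpowers u)) (QuotientGroup.mk'_surjective _) u hu1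
    huu hcen ?_ ?_ (coxS mF4) coxS_f4 hu' ?_ ?_
  · intro w hw
    have hw' : w ∈ Subgroup.zpowers u := (QuotientGroup.eq_one_iff w).mp hw
    obtain ⟨n, rfl⟩ := Subgroup.mem_zpowers_iff.mp hw'
    rcases Int.even_or_odd' n with ⟨m, rfl | rfl⟩
    · left
      rw [zpow_mul, zpow_ofNat, h2, one_zpow]
    · right
      rw [zpow_add, zpow_mul, zpow_ofNat, h2, one_zpow, one_mul, zpow_one]
  · exact (QuotientGroup.eq_one_iff u).mpr (Subgroup.mem_zpowers u)
  · intro H _ t ht ht6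
    obtain ⟨φ, hφ⟩ := f4_univ t ht
    have hφu : φ u = 1 := by
      rw [← hu', map_pow, map_mul, map_mul, map_mul, hφ, hφ, hφ, hφ, ht6]
    refine ⟨QuotientGroup.lift (Subgroup.zpowers u) φ ?_, fun i => ?_⟩
    · intro w hw
      obtain ⟨n, rfl⟩ := Subgroup.mem_zpowers_iff.mp hw
      rw [MonoidHom.mem_ker, map_zpow, hφu, one_zpow]
    · exact hφ i
  · intro φ hφ
    apply QuotientGroup.monoidHom_ext
    apply PresentedGroup.ext
    intro i
    exact hφ i
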